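/- arXiv:1111.5473 — 2 statements merged into one kernel-verified Lean document; each statement's English description precedes it below -/
import Mathlib

section
/- Let y ∈ Las_t(K) and I ⊆ [n] with |I| ≤ t. Then y_I = 1 if and only if y_{\{i\}} = 1 for every i ∈ I. -/
open Finset

/-- Membership in the polyhedron `K = {x : A x ≥ b}`. -/
def memK {n m : ℕ} (A : Matrix (Fin m) (Fin n) ℝ) (b : Fin m → ℝ) (x : Fin n → ℝ) : Prop :=
  ∀ ℓ : Fin m, b ℓ ≤ ∑ i, A ℓ i * x i

/-- The moment matrix of a vector `y` indexed by subsets, truncated at sets of size `≤ t`. -/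
def momentMatrix {α : Type*} [Fintype α] [DecidableEq α] (y : Finset α → ℝ) (t : ℕ) :
    Matrix {I : Finset α // I.card ≤ t} {I : Finset α // I.card ≤ t} ℝ :=
  fun I J => y (I.1 ∪ J.1)

/-- The shift operator `(a;β) * y` for a linear constraint `aᵀx ≥ β`. -/
def shiftVec {α ι : Type*} [Fintype α] [DecidableEq α]
    (A : ι → α → ℝ) (b : ι → ℝ) (ℓ : ι) (y : Finset α → ℝ) : Finset α → ℝ :=
  fun I => (∑ i, A ℓ i * y (insert i I)) - b ℓ * y I

/-- `y ∈ Las_t(K)` where `K = {x : A x ≥ b}`: `y_∅ = 1`, the moment matrix truncated at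
sets of size `≤ t+1` is PSD, and each shifted moment matrix truncated at sets of size
`≤ t` is PSD. -/
def IsLasserre {α ι : Type*} [Fintype α] [DecidableEq α]
    (A : ι → α → ℝ) (b : ι → ℝ) (t : ℕ) (y : Finset α → ℝ) : Prop :=
  y ∅ = 1 ∧ (momentMatrix y (t + 1)).PosSemidef ∧
    ∀ ℓ : ι, (momentMatrix (shiftVec A b ℓ y) t).PosSemidef

theorem quad3 {α : Type*} [Fintype α] [DecidableEq α] (y : Finset α → ℝ) (t : ℕ)
    (h : (momentMatrix y t).PosSemidef) (J K L : Finset α) (hJ : J.card ≤ t) (hK : K.card ≤ t)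
    (hL : L.card ≤ t) (c p q : ℝ) :
    0 ≤ c * c * y J + p * p * y K + q * q * y L + 2 * c * p * y (J ∪ K) + 2 * c * q * y (J ∪ L)
      + 2 * p * q * y (K ∪ L) := by
  have := h.dotProduct_mulVec_nonneg
    (Pi.single ⟨J, hJ⟩ c + Pi.single ⟨K, hK⟩ p + Pi.single ⟨L, hL⟩ q)
  simp only [star_trivial, Matrix.mulVec_add, add_dotProduct, dotProduct_add,
    single_dotProduct, Matrix.mulVec_single, Pi.smul_apply, Matrix.col_apply,
    MulOpposite.smul_eq_mul_unop, MulOpposite.unop_op, momentMatrix, Finset.union_self] at this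
  rw [Finset.union_comm K J, Finset.union_comm L J, Finset.union_comm L K] at this
  linarith

theorem mono_entry {α : Type*} [Fintype α] [DecidableEq α] (y : Finset α → ℝ) (t : ℕ)
    (h : (momentMatrix y t).PosSemidef) (J K : Finset α) (hJK : J ⊆ K) (hK : K.card ≤ t) :
    y K ≤ y J := by
  have := quad3 y t h J K K ((Finset.card_le_card hJK).trans hK) hK hK 1 (-1) 0
  rw [Finset.union_eq_right.2 hJK] at this
  linarith

/-- For `y ∈ Las_t(K)` and `|I| ≤ t`: `y_I = 1` iff `y_{i} = 1` for all `i ∈ I`. -/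
theorem lasserre_entry_one_iff (n m t : ℕ) (A : Matrix (Fin m) (Fin n) ℝ) (b : Fin m → ℝ)
    (y : Finset (Fin n) → ℝ) (hy : IsLasserre (fun ℓ i => A ℓ i) b t y)
    (I : Finset (Fin n)) (hI : I.card ≤ t) :
    y I = 1 ↔ ∀ i ∈ I, y {i} = 1 := by
  obtain ⟨h0, h, -⟩ := hy
  constructor
  · intro h1 i hi
    have e1 := mono_entry y _ h {i} I (by simpa using hi) (by omega)
    have e2 := mono_entry y _ h ∅ {i} (by simp) (by simp)
    linarith
  · induction I using Finset.induction_on with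
    | empty => intro _; exact h0
    | insert a S ha ih =>
      intro H
      have hc := Finset.card_insert_of_notMem ha
      have hS := ih (by omega) (fun i hi => H i (Finset.mem_insert_of_mem hi))
      have h1 := H a (Finset.mem_insert_self a S)
      have e := mono_entry y _ h ∅ (insert a S) (by simp) (by omega)
      have q := quad3 y _ h ∅ {a} S (by simp) (by simp) (by omega) (-2) 1 1
      rw [Finset.empty_union, Finset.empty_union, ← Finset.insert_eq] at q
      linarith
end

section
/- (Integrality gap bound, existence form of the main theorem.) Let G be an ℓ-level Directed Steiner Tree instance with terminal set X, |X| ≥ 2, edge costs c : E → ℝ_{≥0}, and let Y ∈ Las_{2ℓ}(K) be a level-2ℓ Lasserre solution for the Directed Steiner Tree LP K. Then there exists a set of edges T ⊆ E such that for every terminal s ∈ X the set T contains a directed r–s path, and Σ_{e∈T} c_e ≤ (2ℓ·log₂|X| + 1) · Σ_{e∈E} c_e · y_{\{e\}}, where y_{\{e\}} is the entry of Y indexed by the singleton edge variable e. In particular the integrality gap of the level-2ℓ Lasserre strengthening of the LP is O(ℓ·log|X|). -/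
open Finset

/-- An `ℓ`-level Directed Steiner Tree instance: a directed graph on vertex set `V` with edge
set `E`, root `r`, terminal set `X`, whose vertices are arranged in levels
`V_0 = {r}, V_1, …, V_levels = X` with every edge going from one level to the next. -/
structure DSTInstance (V : Type*) [Fintype V] [DecidableEq V] where
  E : Finset (V × V)
  r : V
  X : Finset V
  levels : ℕ
  level : V → ℕ
  level_le : ∀ v, level v ≤ levels
  level_root : ∀ v, level v = 0 ↔ v = r
  level_terminal : ∀ v, level v = levels ↔ v ∈ X
  edge_level : ∀ e ∈ E, level e.2 = level e.1 + 1

variable {V : Type*} [Fintype V] [DecidableEq V]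

/-- LP variables of the Directed Steiner Tree LP: a capacity variable `y_e` for each edge
`e ∈ E` and a flow variable `f_{s,e}` for each terminal `s ∈ X` and edge `e ∈ E`. -/
def DSTVar (G : DSTInstance V) : Type _ :=
  {e : V × V // e ∈ G.E} ⊕ {p : V × (V × V) // p.1 ∈ G.X ∧ p.2 ∈ G.E}

instance (G : DSTInstance V) : Fintype (DSTVar G) :=
  inferInstanceAs (Fintype ({e : V × V // e ∈ G.E} ⊕ {p : V × (V × V) // p.1 ∈ G.X ∧ p.2 ∈ G.E}))

instance (G : DSTInstance V) : DecidableEq (DSTVar G) :=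
  inferInstanceAs (DecidableEq ({e : V × V // e ∈ G.E} ⊕ {p : V × (V × V) // p.1 ∈ G.X ∧ p.2 ∈ G.E}))

/-- Index type for the linear constraints of the Directed Steiner Tree LP: flow conservation
(for each terminal `s ∈ X` and vertex `v`, two inequalities forming an equality), capacity
constraints `f_{s,e} ≤ y_e`, indegree constraints `Σ_{e ∈ δ⁻(v)} y_e ≤ 1`, and the box
constraints `0 ≤ x ≤ 1` for every variable. -/
def DSTCon (G : DSTInstance V) : Type _ :=
  (({s : V // s ∈ G.X} × V) × Bool) ⊕
  ({p : V × (V × V) // p.1 ∈ G.X ∧ p.2 ∈ G.E} ⊕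
  (V ⊕ (DSTVar G × Bool)))

/-- Left-hand side coefficients of the Directed Steiner Tree LP constraints (as `a·x ≥ β`). -/
def dstA (G : DSTInstance V) : DSTCon G → DSTVar G → ℝ
  | Sum.inl ((s, v), d) => fun w =>
      (if d then (1 : ℝ) else -1) *
        (match w with
          | Sum.inl _ => 0
          | Sum.inr p =>
              if p.1.1 = s.1 then
                (if p.1.2.1 = v then (1 : ℝ) else 0) - (if p.1.2.2 = v then (1 : ℝ) else 0)
              else 0)
  | Sum.inr (Sum.inl p) => fun w =>
      (match w with
        | Sum.inl e => if e.1 = p.1.2 then (1 : ℝ) else 0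
        | Sum.inr q => if q.1 = p.1 then (-1 : ℝ) else 0)
  | Sum.inr (Sum.inr (Sum.inl v)) => fun w =>
      (match w with
        | Sum.inl e => if e.1.2 = v then (-1 : ℝ) else 0
        | Sum.inr _ => 0)
  | Sum.inr (Sum.inr (Sum.inr (w0, d))) => fun w =>
      if w = w0 then (if d then (1 : ℝ) else -1) else 0

/-- Right-hand sides of the Directed Steiner Tree LP constraints (as `a·x ≥ β`). -/
def dstb (G : DSTInstance V) : DSTCon G → ℝ
  | Sum.inl ((s, v), d) =>
      (if d then (1 : ℝ) else -1) *
        (if v = G.r then 1 else if v = s.1 then -1 else 0)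
  | Sum.inr (Sum.inl _) => 0
  | Sum.inr (Sum.inr (Sum.inl _)) => -1
  | Sum.inr (Sum.inr (Sum.inr (_, d))) => if d then (0 : ℝ) else -1

/-- `IsRPath G P v`: the edge set `P` is a directed path from the root `r` to `v` in `G`. -/
inductive IsRPath (G : DSTInstance V) : Finset (V × V) → V → Prop
  | nil : IsRPath G ∅ G.r
  | cons {P : Finset (V × V)} {u v : V} :
      IsRPath G P u → (u, v) ∈ G.E → IsRPath G (insert (u, v) P) v

/-- The set of Lasserre variables corresponding to the capacity variables `y_e`, `e ∈ P`. -/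
def edgeVars (G : DSTInstance V) (P : Finset (V × V)) : Finset (DSTVar G) :=
  ((Finset.univ : Finset {e : V × V // e ∈ G.E}).filter (fun e => e.1 ∈ P)).image Sum.inl

set_option linter.unusedSectionVars false


/-- `s` is reachable from `u` using edges of `T`. -/
def Reach (T : Finset (V × V)) (u s : V) : Prop :=
  Relation.ReflTransGen (fun a b => (a, b) ∈ T) u s

open Classical in
/-- Indicator of non-reachability. -/
noncomputable def nrch (T : Finset (V × V)) (u s : V) : ℝ := if Reach T u s then 0 else 1

lemma Reach.mono {T T' : Finset (V × V)} (h : T ⊆ T') {u s : V} (hr : Reach T u s) :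
    Reach T' u s := by
  induction hr with
  | refl => exact Relation.ReflTransGen.refl
  | tail _ hab ih => exact Relation.ReflTransGen.tail ih (h hab)

lemma nrch_nonneg (T : Finset (V × V)) (u s : V) : 0 ≤ nrch T u s := by
  unfold nrch; split_ifs <;> norm_num

lemma nrch_le_one (T : Finset (V × V)) (u s : V) : nrch T u s ≤ 1 := by
  unfold nrch; split_ifs <;> norm_num

lemma nrch_union (T T' : Finset (V × V)) (u s : V) :
    nrch (T ∪ T') u s ≤ nrch T u s * nrch T' u s := by
  by_cases h : Reach (T ∪ T') u s
  · have : nrch (T ∪ T') u s = 0 := by simp [nrch, h]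
    rw [this]; exact mul_nonneg (nrch_nonneg _ _ _) (nrch_nonneg _ _ _)
  · have h1 : ¬ Reach T u s := fun hh => h (hh.mono subset_union_left)
    have h2 : ¬ Reach T' u s := fun hh => h (hh.mono subset_union_right)
    simp [nrch, h, h1, h2]

lemma nrch_insert (T : Finset (V × V)) (u v s : V) :
    nrch (insert (u, v) T) u s ≤ nrch T v s := by
  by_cases h : Reach T v s
  · have : Reach (insert (u, v) T) u s :=
      Relation.ReflTransGen.head (mem_insert_self _ _) (h.mono (subset_insert _ _))
    simp [nrch, h, this]
  · have : nrch T v s = 1 := by simp [nrch, h]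
    rw [this]; exact nrch_le_one _ _ _

/-- Derandomised form of there is a random edge set of expected cost `C` such that `s` is not
reached from `u` with probability at most `g s`. -/
def Ach (G : DSTInstance V) (c : V × V → ℝ) (u : V) (C : ℝ) (g : V → ℝ) : Prop :=
  ∀ w : V → ℝ, (∀ s, 0 ≤ w s) → ∃ T ⊆ G.E,
    ∑ e ∈ T, c e + ∑ s ∈ G.X, w s * nrch T u s ≤ C + ∑ s ∈ G.X, w s * g s

lemma Ach.mono {G : DSTInstance V} {c : V × V → ℝ} {u : V} {C C' : ℝ} {g g' : V → ℝ}
    (h : Ach G c u C g) (hC : C ≤ C') (hg : ∀ s ∈ G.X, g s ≤ g' s) : Ach G c u C' g' := by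
  intro w hw
  obtain ⟨T, hT, hh⟩ := h w hw
  refine ⟨T, hT, hh.trans (add_le_add hC (sum_le_sum fun s hs => ?_))⟩
  exact mul_le_mul_of_nonneg_left (hg s hs) (hw s)

lemma Ach.empty (G : DSTInstance V) (c : V × V → ℝ) (u : V) :
    Ach G c u 0 (fun s => if u = s then 0 else 1) := by
  intro w hw
  refine ⟨∅, empty_subset _, ?_⟩
  simp only [sum_empty]
  gcongr with s hs
  · exact hw s
  · split_ifs with h
    · subst h
      have : Reach (∅ : Finset (V × V)) u u := Relation.ReflTransGen.refl
      simp [nrch, this]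
    · exact nrch_le_one _ _ _

lemma Ach.one (G : DSTInstance V) (c : V × V → ℝ) (u : V) :
    Ach G c u 0 (fun _ => 1) :=
  (Ach.empty G c u).mono le_rfl (fun s _ => by split_ifs <;> norm_num)

lemma Ach.union {G : DSTInstance V} {c : V × V → ℝ} (hc : ∀ e ∈ G.E, 0 ≤ c e)
    {u : V} {C₁ C₂ : ℝ} {g₁ g₂ : V → ℝ}
    (h₁ : Ach G c u C₁ g₁) (h₂ : Ach G c u C₂ g₂) (hg : ∀ s ∈ G.X, 0 ≤ g₂ s) :
    Ach G c u (C₁ + C₂) (fun s => g₁ s * g₂ s) := by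
  intro w hw
  obtain ⟨T₁, hT₁, k₁⟩ := h₁ (fun s => w s * max (g₂ s) 0)
    (fun s => mul_nonneg (hw s) (le_max_right _ _))
  obtain ⟨T₂, hT₂, k₂⟩ := h₂ (fun s => w s * nrch T₁ u s)
    (fun s => mul_nonneg (hw s) (nrch_nonneg _ _ _))
  refine ⟨T₁ ∪ T₂, union_subset hT₁ hT₂, ?_⟩
  have a1 : ∑ s ∈ G.X, w s * max (g₂ s) 0 * nrch T₁ u s
      = ∑ s ∈ G.X, w s * nrch T₁ u s * g₂ s :=
    sum_congr rfl fun s hs => by rw [max_eq_left (hg s hs)]; ring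
  have a2 : ∑ s ∈ G.X, w s * max (g₂ s) 0 * g₁ s = ∑ s ∈ G.X, w s * (g₁ s * g₂ s) :=
    sum_congr rfl fun s hs => by rw [max_eq_left (hg s hs)]; ring
  have a3 : ∑ s ∈ G.X, w s * nrch (T₁ ∪ T₂) u s
      ≤ ∑ s ∈ G.X, w s * nrch T₁ u s * nrch T₂ u s :=
    sum_le_sum fun s _ => by
      rw [mul_assoc]; exact mul_le_mul_of_nonneg_left (nrch_union _ _ _ _) (hw s)
  have a4 : ∑ e ∈ T₁ ∪ T₂, c e ≤ ∑ e ∈ T₁, c e + ∑ e ∈ T₂, c e := by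
    rw [← sum_union_inter]
    have : 0 ≤ ∑ e ∈ T₁ ∩ T₂, c e :=
      sum_nonneg fun e he => hc e (hT₁ (mem_inter.1 he).1)
    linarith
  rw [a1, a2] at k₁
  linarith

lemma Ach.step {G : DSTInstance V} {c : V × V → ℝ} (hc : ∀ e ∈ G.E, 0 ≤ c e)
    {e : V × V} (he : e ∈ G.E) {C p : ℝ} {g : V → ℝ} (hp0 : 0 ≤ p) (hp1 : p ≤ 1)
    (h : Ach G c e.2 C g) :
    Ach G c e.1 (p * (c e + C)) (fun s => 1 - p + p * g s) := by
  intro w hw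
  obtain ⟨T, hT, k⟩ := h w hw
  by_cases hh : c e + C + ∑ s ∈ G.X, w s * g s ≤ ∑ s ∈ G.X, w s
  · refine ⟨insert e T, insert_subset he hT, ?_⟩
    have a1 : ∑ x ∈ insert e T, c x ≤ c e + ∑ x ∈ T, c x := by
      by_cases hm : e ∈ T
      · rw [insert_eq_of_mem hm]; linarith [hc e he]
      · rw [sum_insert hm]
    have a2 : ∑ s ∈ G.X, w s * nrch (insert e T) e.1 s ≤ ∑ s ∈ G.X, w s * nrch T e.2 s :=
      sum_le_sum fun s _ => mul_le_mul_of_nonneg_left (nrch_insert T e.1 e.2 s) (hw s)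
    have a3 : ∑ s ∈ G.X, w s * (1 - p + p * g s)
        = (1 - p) * ∑ s ∈ G.X, w s + p * ∑ s ∈ G.X, w s * g s := by
      rw [mul_sum, mul_sum, ← sum_add_distrib]; exact sum_congr rfl fun s _ => by ring
    rw [a3]
    nlinarith [mul_le_mul_of_nonneg_left hh (sub_nonneg.2 hp1)]
  · push Not at hh
    refine ⟨∅, empty_subset _, ?_⟩
    have a2 : ∑ s ∈ G.X, w s * nrch ∅ e.1 s ≤ ∑ s ∈ G.X, w s :=
      sum_le_sum fun s _ => mul_le_of_le_one_right (hw s) (nrch_le_one _ _ _)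
    have a3 : ∑ s ∈ G.X, w s * (1 - p + p * g s)
        = (1 - p) * ∑ s ∈ G.X, w s + p * ∑ s ∈ G.X, w s * g s := by
      rw [mul_sum, mul_sum, ← sum_add_distrib]; exact sum_congr rfl fun s _ => by ring
    rw [a3, sum_empty]
    nlinarith [mul_le_mul_of_nonneg_left hh.le hp0]

lemma Ach.prod {G : DSTInstance V} {c : V × V → ℝ} (hc : ∀ e ∈ G.E, 0 ≤ c e)
    {u : V} {κ : Type*} (J : Finset κ) (C : κ → ℝ) (g : κ → V → ℝ)
    (h : ∀ j ∈ J, Ach G c u (C j) (g j)) (hg : ∀ j ∈ J, ∀ s ∈ G.X, 0 ≤ g j s) :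
    Ach G c u (∑ j ∈ J, C j) (fun s => ∏ j ∈ J, g j s) := by
  classical
  induction J using Finset.induction_on with
  | empty => simpa using Ach.one G c u
  | insert a J ha ih =>
    have := Ach.union hc (h a (mem_insert_self _ _))
      (ih (fun j hj => h j (mem_insert_of_mem hj)) (fun j hj => hg j (mem_insert_of_mem hj)))
      (fun s hs => prod_nonneg fun j hj => hg j (mem_insert_of_mem hj) s hs)
    simpa only [sum_insert ha, prod_insert ha] using this

/-! ### Sums over walks -/

/-- Sum of `F (P ∪ edges of Q)` over all walks `Q` with `n` edges from `u` to `v`. -/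
def W (G : DSTInstance V) : ℕ → V → V → (Finset (V × V) → ℝ) → Finset (V × V) → ℝ
  | 0, u, v, F, P => if u = v then F P else 0
  | n + 1, u, v, F, P => ∑ e ∈ G.E.filter (fun e => e.1 = u), W G n e.2 v F (insert e P)

lemma W_back (G : DSTInstance V) (n : ℕ) (u v : V) (F : Finset (V × V) → ℝ)
    (P : Finset (V × V)) :
    W G (n + 1) u v F P = ∑ e ∈ G.E.filter (fun e => e.2 = v), W G n u e.1 F (insert e P) := by
  induction n generalizing u P with
  | zero =>
    simp only [W, sum_filter]
    refine sum_congr rfl fun e _ => ?_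
    by_cases h1 : e.1 = u <;> by_cases h2 : e.2 = v <;> simp [h1, h2, eq_comm]
    all_goals (intro h; exact absurd h.symm h1)
  | succ n ih =>
    rw [W]
    simp_rw [ih]
    rw [sum_comm]
    refine sum_congr rfl fun e _ => ?_
    rw [W]
    exact sum_congr rfl fun e' _ => by rw [insert_comm]

lemma W_mono (G : DSTInstance V) (n : ℕ) (u v : V) (F F' : Finset (V × V) → ℝ)
    (P : Finset (V × V)) 
    (h : ∀ R, P ⊆ R → R ⊆ G.E ∪ P → R.card ≤ P.card + n → Reach R u v → F R ≤ F' R) :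
    W G n u v F P ≤ W G n u v F' P := by
  induction n generalizing u P with
  | zero =>
    simp only [W]
    split_ifs with huv
    · subst huv
      exact h P subset_rfl subset_union_right (by simp) Relation.ReflTransGen.refl
    · exact le_rfl
  | succ n ih =>
    simp only [W]
    refine sum_le_sum fun e he => ih _ _ fun R h1 h2 h3 h4 => ?_
    obtain ⟨heE, hu⟩ := mem_filter.1 he
    refine h R ((subset_insert _ _).trans h1) (h2.trans ?_) ?_ ?_
    · rw [union_insert]
      exact insert_subset (mem_union_left _ heE) subset_rfl
    · have := card_insert_le e P; omega
    · subst hu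
      exact Relation.ReflTransGen.head (h1 (mem_insert_self _ _)) h4

lemma W_zero (G : DSTInstance V) (n : ℕ) (u v : V) (P : Finset (V × V)) :
    W G n u v (fun _ => 0) P = 0 := by
  induction n generalizing u P with
  | zero => simp [W]
  | succ n ih => simp [W, ih]

lemma W_sum (G : DSTInstance V) (n : ℕ) (u v : V) (P : Finset (V × V)) {κ : Type*}
    (J : Finset κ) (a : κ → ℝ) (F : κ → Finset (V × V) → ℝ) :
    W G n u v (fun R => ∑ j ∈ J, a j * F j R) P = ∑ j ∈ J, a j * W G n u v (F j) P := by
  induction n generalizing u P with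
  | zero => simp only [W]; split_ifs <;> simp
  | succ n ih =>
    simp only [W, ih]
    rw [sum_comm]
    exact sum_congr rfl fun j _ => by rw [mul_sum]

lemma W_smul (G : DSTInstance V) (n : ℕ) (u v : V) (P : Finset (V × V)) (a : ℝ)
    (F : Finset (V × V) → ℝ) :
    W G n u v (fun R => a * F R) P = a * W G n u v F P := by
  simpa using W_sum G n u v P {()} (fun _ => a) (fun _ => F)

lemma W_shift (G : DSTInstance V) (n : ℕ) (u v : V) (e : V × V) (F : Finset (V × V) → ℝ)
    (P : Finset (V × V)) :
    W G n u v (fun R => F (insert e R)) P = W G n u v F (insert e P) := by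
  induction n generalizing u P with
  | zero => simp [W]
  | succ n ih =>
    simp only [W, ih]
    exact sum_congr rfl fun e' _ => by rw [insert_comm]

lemma W_level (G : DSTInstance V) (n : ℕ) (u v : V) (F : Finset (V × V) → ℝ)
    (P : Finset (V × V)) (h : G.level v ≠ G.level u + n) : W G n u v F P = 0 := by
  induction n generalizing u P with
  | zero =>
    simp only [W]
    rw [if_neg]; rintro rfl; simp at h
  | succ n ih =>
    simp only [W]
    refine sum_eq_zero fun e he => ih _ _ ?_
    obtain ⟨heE, hu⟩ := mem_filter.1 he
    have := G.edge_level e heE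
    rw [hu] at this; omega

lemma W_nonneg (G : DSTInstance V) (n : ℕ) (u v : V) (F : Finset (V × V) → ℝ)
    (P : Finset (V × V)) (L : ℕ) (hF : ∀ R, R.card ≤ L → 0 ≤ F R) (h : P.card + n ≤ L) :
    0 ≤ W G n u v F P := by
  rw [← W_zero G n u v P]
  exact W_mono _ _ _ _ _ _ _ fun R _ _ h3 _ => hF R (by omega)

section core

variable (G : DSTInstance V) (c : V × V → ℝ) (y : Finset (V × V) → ℝ)

lemma W_le (L : ℕ) (hin : ∀ P v, P.card ≤ L →
      ∑ e ∈ G.E.filter (fun e => e.2 = v), y (insert e P) ≤ y P)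
    (hpos : ∀ P : Finset (V × V), P.card ≤ L + 1 → 0 ≤ y P)
    (n : ℕ) (u v : V) (P : Finset (V × V)) (h : P.card + n ≤ L + 1) :
    W G n u v y P ≤ y P := by
  induction n generalizing v P with
  | zero =>
    simp only [W]; split_ifs
    · exact le_rfl
    · exact hpos _ (by omega)
  | succ n ih =>
    rw [W_back]
    refine (sum_le_sum fun e _ => ih e.1 (insert e P) ?_).trans (hin P v (by omega))
    have := card_insert_le e P; omega

/-- Unnormalised expected cost of the branching process below a path. -/
noncomputable def pcost (n : ℕ) (u : V) (P : Finset (V × V)) : ℝ :=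
  ∑ m ∈ range n, ∑ e ∈ G.E, c e * W G m u e.1 y (insert e P)

lemma pcost_succ (n : ℕ) (u : V) (P : Finset (V × V)) :
    pcost G c y (n + 1) u P = ∑ e ∈ G.E.filter (fun e => e.1 = u),
      (c e * y (insert e P) + pcost G c y n e.2 (insert e P)) := by
  unfold pcost
  rw [sum_range_succ', sum_add_distrib, add_comm]
  congr 1
  · simp only [W, sum_filter]
    refine sum_congr rfl fun e _ => ?_
    by_cases h : e.1 = u <;> simp [h, eq_comm]
    intro h'; exact absurd h'.symm h
  · rw [eq_comm, sum_comm]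
    refine sum_congr rfl fun m _ => ?_
    rw [sum_comm]
    refine sum_congr rfl fun e _ => ?_
    rw [W, mul_sum]
    exact sum_congr rfl fun e' _ => by rw [insert_comm]

lemma prod_aux {κ : Type*} (J : Finset κ) (a : κ → ℝ) (h0 : ∀ j ∈ J, 0 ≤ a j)
    (h1 : ∀ j ∈ J, a j ≤ 1) : (∏ j ∈ J, (1 - a j)) * (1 + ∑ j ∈ J, a j) ≤ 1 := by
  classical
  induction J using Finset.induction_on with
  | empty => simp
  | insert b J hb ih =>
    rw [prod_insert hb, sum_insert hb]
    have i := ih (fun j hj => h0 j (mem_insert_of_mem hj)) (fun j hj => h1 j (mem_insert_of_mem hj))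
    have hA : 0 ≤ ∑ j ∈ J, a j := sum_nonneg fun j hj => h0 j (mem_insert_of_mem hj)
    have hQ : 0 ≤ ∏ j ∈ J, (1 - a j) :=
      prod_nonneg fun j hj => sub_nonneg.2 (h1 j (mem_insert_of_mem hj))
    have hb0 := h0 b (mem_insert_self _ _)
    have hb1 := h1 b (mem_insert_self _ _)
    set A := ∑ j ∈ J, a j
    set Q := ∏ j ∈ J, (1 - a j)
    have k : (1 - a b) * (1 + (a b + A)) ≤ 1 + A := by nlinarith [mul_nonneg hb0 hA]
    calc (1 - a b) * Q * (1 + (a b + A)) = Q * ((1 - a b) * (1 + (a b + A))) := by ring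
      _ ≤ Q * (1 + A) := mul_le_mul_of_nonneg_left k hQ
      _ ≤ 1 := i

lemma prod_aux2 {κ : Type*} (J : Finset κ) (x : κ → ℝ) (n : ℕ) (h0 : ∀ j ∈ J, 0 ≤ x j)
    (h1 : ∑ j ∈ J, x j ≤ 1) :
    ∏ j ∈ J, (1 - x j / (n + 1 : ℝ)) ≤ 1 - (∑ j ∈ J, x j) / ((n + 1 : ℕ) + 1 : ℝ) := by
  have hn : (0 : ℝ) < n + 1 := by positivity
  have hx1 : ∀ j ∈ J, x j ≤ 1 := fun j hj => (single_le_sum h0 hj).trans h1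
  have k := prod_aux J (fun j => x j / (n + 1 : ℝ)) (fun j hj => div_nonneg (h0 j hj) hn.le)
    (fun j hj => by
      rw [div_le_one hn]
      have := hx1 j hj
      have : (0 : ℝ) ≤ n := Nat.cast_nonneg n
      linarith [hx1 j hj])
  rw [← sum_div] at k
  have hS : 0 ≤ ∑ j ∈ J, x j := sum_nonneg h0
  set S := ∑ j ∈ J, x j
  have hpos : 0 < 1 + S / (n + 1 : ℝ) := by positivity
  rw [← le_div_iff₀ hpos] at k
  refine k.trans ?_
  rw [div_le_iff₀ hpos]
  push_cast
  have e : (1 - S / ((n : ℝ) + 1 + 1)) * (1 + S / (n + 1)) - 1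
      = S * (1 - S) / ((n + 1) * (n + 1 + 1)) := by field_simp; ring
  have : 0 ≤ S * (1 - S) / (((n : ℝ) + 1) * (n + 1 + 1)) := by
    apply div_nonneg (mul_nonneg hS (by linarith)) (by positivity)
  linarith

lemma branch (hc : ∀ e ∈ G.E, 0 ≤ c e) (L : ℕ)
    (hin : ∀ P v, P.card ≤ L →
      ∑ e ∈ G.E.filter (fun e => e.2 = v), y (insert e P) ≤ y P)
    (hpos : ∀ P : Finset (V × V), P.card ≤ L + 1 → 0 ≤ y P)
    (n : ℕ) (u : V) (P : Finset (V × V)) (h : P.card + n ≤ L) (hP : 0 < y P) :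
    Ach G c u (pcost G c y n u P / y P)
      (fun s => 1 - W G n u s y P / y P / (n + 1 : ℝ)) := by
  induction n generalizing u P with
  | zero =>
    refine (Ach.empty G c u).mono (by simp [pcost]) fun s _ => ?_
    simp only [W]
    split_ifs <;> simp [hP.ne']
  | succ n ih =>
    have hcard : ∀ e, (insert e P).card ≤ P.card + 1 := fun e => card_insert_le e P
    have hmono : ∀ e ∈ G.E, y (insert e P) ≤ y P := fun e he =>
      (single_le_sum (f := fun e => y (insert e P))
        (fun e' _ => hpos _ (by have := hcard e'; omega))
        (mem_filter.2 ⟨he, rfl⟩ : e ∈ G.E.filter (fun e' => e'.2 = e.2))).trans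
        (hin P e.2 (by omega))
    have hWe : ∀ e s, 0 ≤ W G n e.2 s y (insert e P) := fun e s =>
      W_nonneg _ _ _ _ _ _ (L + 1) hpos (by have := hcard e; omega)
    have hWle : ∀ e s, W G n e.2 s y (insert e P) ≤ y (insert e P) := fun e s =>
      W_le G y L hin hpos n _ _ _ (by have := hcard e; omega)
    have hn : (0 : ℝ) < n + 1 := by positivity
    have key : ∀ e ∈ G.E.filter (fun e => e.1 = u), Ach G c u
        ((c e * y (insert e P) + pcost G c y n e.2 (insert e P)) / y P)
        (fun s => 1 - W G n e.2 s y (insert e P) / y P / (n + 1 : ℝ)) := by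
      intro e he
      obtain ⟨heE, hu⟩ := mem_filter.1 he
      have hye : 0 ≤ y (insert e P) := hpos _ (by have := hcard e; omega)
      rcases hye.eq_or_lt with h0 | h0
      · refine (Ach.one G c u).mono ?_ fun s _ => ?_
        · refine div_nonneg (add_nonneg (mul_nonneg (hc e heE) hye) ?_) hP.le
          refine sum_nonneg fun m hm => sum_nonneg fun e' he' => mul_nonneg (hc e' he') ?_
          refine W_nonneg _ _ _ _ _ _ (L + 1) hpos ?_
          have h1 := hcard e
          have h2 := card_insert_le e' (insert e P)
          have h3 := mem_range.1 hm
          omega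
        · have : W G n e.2 s y (insert e P) = 0 :=
            le_antisymm ((hWle e s).trans h0.symm.le) (hWe e s)
          simp [this]
      · have := Ach.step hc heE (p := y (insert e P) / y P) (div_nonneg hye hP.le)
          ((div_le_one hP).2 (hmono e heE))
          (ih e.2 (insert e P) (by have := hcard e; omega) h0)
        rw [hu] at this
        refine this.mono (le_of_eq ?_) fun s _ => le_of_eq ?_
        · field_simp
        · field_simp; ring
    have hx1 : ∀ s, W G (n + 1) u s y P / y P ≤ 1 := fun s =>
      (div_le_one hP).2 (W_le G y L hin hpos (n + 1) _ _ _ (by omega))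
    refine (Ach.prod hc _ _ _ key ?_).mono ?_ ?_
    · intro e he s _
      have h1 := hWle e s
      have h2 := hmono e (mem_filter.1 he).1
      have h3 : W G n e.2 s y (insert e P) / y P ≤ 1 := (div_le_one hP).2 (h1.trans h2)
      rw [sub_nonneg, div_le_one hn]
      have : (0 : ℝ) ≤ n := Nat.cast_nonneg n
      linarith
    · rw [pcost_succ, sum_div]
    · intro s _
      have hs := hx1 s
      rw [W, sum_div] at hs ⊢
      exact prod_aux2 _ _ n (fun e _ => div_nonneg (hWe e s) hP.le) hs

lemma pcost_root_le (hc : ∀ e ∈ G.E, 0 ≤ c e) (L : ℕ)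
    (hin : ∀ P v, P.card ≤ L →
      ∑ e ∈ G.E.filter (fun e => e.2 = v), y (insert e P) ≤ y P)
    (hpos : ∀ P : Finset (V × V), P.card ≤ L + 1 → 0 ≤ y P) (n : ℕ) (hn : n ≤ L) :
    pcost G c y n G.r ∅ ≤ ∑ e ∈ G.E, c e * y {e} := by
  unfold pcost
  rw [sum_comm]
  refine sum_le_sum fun e he => ?_
  rw [← mul_sum]
  refine mul_le_mul_of_nonneg_left ?_ (hc e he)
  by_cases hm : G.level e.1 ∈ range n
  · rw [sum_eq_single_of_mem _ hm]
    · exact W_le G y L hin hpos _ _ _ _ (by have := mem_range.1 hm; simp; omega)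
    · intro m _ hne
      apply W_level
      rw [(G.level_root G.r).2 rfl]; omega
  · rw [sum_eq_zero]
    · exact hpos _ (by simp)
    · intro m hm' 
      apply W_level
      rw [(G.level_root G.r).2 rfl]; rintro h; apply hm; rw [h]; simpa using hm'

lemma cheap_path (hc : ∀ e ∈ G.E, 0 ≤ c e) (L : ℕ)
    (hin : ∀ P v, P.card ≤ L →
      ∑ e ∈ G.E.filter (fun e => e.2 = v), y (insert e P) ≤ y P)
    (hpos : ∀ P : Finset (V × V), P.card ≤ L + 1 → 0 ≤ y P) (n : ℕ) (hn : n ≤ L)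
    (s : V) (hs : 1 ≤ W G n G.r s y ∅) :
    ∃ T ⊆ G.E, Reach T G.r s ∧ ∑ e ∈ T, c e ≤ ∑ e ∈ G.E, c e * y {e} := by
  classical
  let S := G.E.powerset.filter (fun T => Reach T G.r s)
  have hne : S.Nonempty := by
    by_contra hS
    rw [not_nonempty_iff_eq_empty] at hS
    have : W G n G.r s y ∅ ≤ W G n G.r s (fun _ => 0) ∅ :=
      W_mono _ _ _ _ _ _ _ fun R _ h2 _ h4 => by
        have : R ∈ S := mem_filter.2 ⟨mem_powerset.2 (by simpa using h2), h4⟩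
        rw [hS] at this; simp at this
    rw [W_zero] at this; linarith
  obtain ⟨T, hT, hmin⟩ := exists_min_image S (fun T => ∑ e ∈ T, c e) hne
  obtain ⟨hT1, hT2⟩ := mem_filter.1 hT
  rw [mem_powerset] at hT1
  refine ⟨T, hT1, hT2, ?_⟩
  have hd : 0 ≤ ∑ e ∈ T, c e := sum_nonneg fun e he => hc e (hT1 he)
  calc ∑ e ∈ T, c e ≤ (∑ e ∈ T, c e) * W G n G.r s y ∅ := le_mul_of_one_le_right hd hs
    _ = W G n G.r s (fun R => (∑ e ∈ T, c e) * y R) ∅ := (W_smul ..).symm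
    _ ≤ W G n G.r s (fun R => ∑ e ∈ G.E, c e * y (insert e R)) ∅ := by
      refine W_mono _ _ _ _ _ _ _ fun R _ h2 h3 h4 => ?_
      have h2' : R ⊆ G.E := by simpa using h2
      simp only [card_empty] at h3
      have hm := hmin R (mem_filter.2 ⟨mem_powerset.2 h2', h4⟩)
      calc (∑ e ∈ T, c e) * y R ≤ (∑ e ∈ R, c e) * y R :=
            mul_le_mul_of_nonneg_right hm (hpos R (by omega))
        _ = ∑ e ∈ R, c e * y (insert e R) := by
            rw [sum_mul]; exact sum_congr rfl fun e he => by rw [insert_eq_of_mem he]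
        _ ≤ _ := sum_le_sum_of_subset_of_nonneg h2' fun e he _ =>
            mul_nonneg (hc e he) (hpos _ (by have := card_insert_le e R; omega))
    _ = ∑ e ∈ G.E, c e * W G n G.r s y {e} := by
      rw [W_sum]
      exact sum_congr rfl fun e _ => by rw [W_shift]; rfl
    _ ≤ _ := sum_le_sum fun e he => mul_le_mul_of_nonneg_left
      (W_le G y L hin hpos _ _ _ _ (by simp; omega)) (hc e he)

lemma rounds_bound (l k : ℕ) (hl : 1 ≤ l) (hk : 2 ≤ k) :
    ∃ N : ℕ, (N : ℝ) ≤ 2 * (l : ℝ) * Real.logb 2 k ∧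
      (k : ℝ) * (1 - 1 / (l + 1 : ℝ)) ^ N ≤ 1 := by
  have hl0 : (0 : ℝ) < l := by exact_mod_cast hl
  have hk0 : (2 : ℝ) ≤ k := by exact_mod_cast hk
  have hlog : 0 ≤ Real.logb 2 k := Real.logb_nonneg (by norm_num) (by linarith)
  have hx : 0 ≤ 2 * (l : ℝ) * Real.logb 2 k := by positivity
  refine ⟨⌊2 * (l : ℝ) * Real.logb 2 k⌋₊, Nat.floor_le hx, ?_⟩
  set N := ⌊2 * (l : ℝ) * Real.logb 2 k⌋₊ with hN
  have hlt : 2 * (l : ℝ) * Real.logb 2 k < N + 1 := Nat.lt_floor_add_one _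
  set b : ℝ := 1 + 1 / l with hb
  have hbpos : 0 < b := by positivity
  have e1 : (1 - 1 / (l + 1 : ℝ)) = b⁻¹ := by rw [hb]; field_simp; ring
  have hbern : (2 : ℝ) ≤ b ^ l := by
    have := one_add_mul_le_pow (a := (1 : ℝ) / l) (by have : (0:ℝ) ≤ 1 / l := by positivity
                                                      linarith) l
    have h2 : (l : ℝ) * (1 / l) = 1 := by field_simp
    rw [h2] at this; linarith
  rw [e1, inv_pow, ← div_eq_mul_inv, div_le_one (by positivity)]
  -- `log k ≤ N log b`
  have hb2 : Real.log 2 ≤ l * Real.log b := by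
    rw [← Real.log_pow]; exact Real.log_le_log (by norm_num) hbern
  have hl2 : 0 < Real.log 2 := Real.log_pos (by norm_num)
  have hlk : Real.logb 2 k * Real.log 2 = Real.log k := by
    rw [Real.logb]; field_simp
  have hlogk : Real.log 2 ≤ Real.log k := Real.log_le_log (by norm_num) hk0
  have h1 : 1 ≤ Real.logb 2 k := by
    rw [Real.logb, le_div_iff₀ hl2]; linarith
  have hNl : (l : ℝ) * Real.logb 2 k ≤ N := by
    have : (1 : ℝ) ≤ l := by exact_mod_cast hl
    nlinarith
  rw [← Real.log_le_log_iff (by linarith) (by positivity), Real.log_pow]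
  have hbl : 0 ≤ Real.log b := Real.log_nonneg (by rw [hb]; have : (0:ℝ) ≤ 1 / l := by positivity
                                                   linarith)
  calc Real.log k = Real.logb 2 k * Real.log 2 := hlk.symm
    _ ≤ Real.logb 2 k * (l * Real.log b) := mul_le_mul_of_nonneg_left hb2 hlog
    _ = (l * Real.logb 2 k) * Real.log b := by ring
    _ ≤ N * Real.log b := mul_le_mul_of_nonneg_right hNl hbl

lemma Reach.isRPath {T : Finset (V × V)} (hT : T ⊆ G.E) {s : V} (h : Reach T G.r s) :
    ∃ P, IsRPath G P s ∧ P ⊆ T := by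
  induction h with
  | refl => exact ⟨∅, IsRPath.nil, empty_subset _⟩
  | tail _ hab ih =>
    obtain ⟨P, hP, hPT⟩ := ih
    exact ⟨_, IsRPath.cons hP (hT hab), insert_subset hab hPT⟩

lemma core (hc : ∀ e ∈ G.E, 0 ≤ c e) (hX : 2 ≤ G.X.card) (hl : 1 ≤ G.levels)
    (L : ℕ) (hL : G.levels ≤ L)
    (hin : ∀ P v, P.card ≤ L →
      ∑ e ∈ G.E.filter (fun e => e.2 = v), y (insert e P) ≤ y P)
    (hpos : ∀ P : Finset (V × V), P.card ≤ L + 1 → 0 ≤ y P) (hy : y ∅ = 1)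
    (hs : ∀ s ∈ G.X, 1 ≤ W G G.levels G.r s y ∅) :
    ∃ T : Finset (V × V), T ⊆ G.E ∧ (∀ s ∈ G.X, Reach T G.r s) ∧
      ∑ e ∈ T, c e ≤
        (2 * (G.levels : ℝ) * Real.logb 2 (G.X.card : ℝ) + 1) * ∑ e ∈ G.E, c e * y {e} := by
  classical
  set LP := ∑ e ∈ G.E, c e * y {e} with hLP
  have hLP0 : 0 ≤ LP := sum_nonneg fun e he => mul_nonneg (hc e he) (hpos _ (by simp))
  obtain ⟨N, hN1, hN2⟩ := rounds_bound G.levels G.X.card hl hX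
  have hb := branch G c y hc L hin hpos G.levels G.r ∅ (by simpa using hL) (by rw [hy]; norm_num)
  have hb' : Ach G c G.r LP (fun _ => 1 - 1 / (G.levels + 1 : ℝ)) := by
    refine hb.mono ?_ fun s hsX => ?_
    · rw [hy, div_one]; exact pcost_root_le G c y hc L hin hpos _ hL
    · rw [hy, div_one]
      have := hs s hsX
      gcongr
  have hg0 : 0 ≤ 1 - 1 / (G.levels + 1 : ℝ) := by
    rw [sub_nonneg, div_le_one (by positivity)]
    have : (0 : ℝ) ≤ G.levels := Nat.cast_nonneg _
    linarith
  have hN := Ach.prod hc (range N) (fun _ => LP) (fun _ _ => 1 - 1 / (G.levels + 1 : ℝ))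
    (fun _ _ => hb') (fun _ _ _ _ => hg0)
  obtain ⟨T, hT, hcost⟩ := hN (fun _ => LP) (fun _ => hLP0)
  simp only [sum_const, prod_const, card_range, nsmul_eq_mul] at hcost
  have hch : ∀ s : V, ∃ T ⊆ G.E, s ∈ G.X → (Reach T G.r s ∧ ∑ e ∈ T, c e ≤ LP) := by
    intro s
    by_cases hsX : s ∈ G.X
    · obtain ⟨T, a, b⟩ := cheap_path G c y hc L hin hpos _ hL s (hs s hsX)
      exact ⟨T, a, fun _ => b⟩
    · exact ⟨∅, empty_subset _, fun h => absurd h hsX⟩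
  choose Q hQE hQ using hch
  let U := G.X.filter (fun s => ¬ Reach T G.r s)
  refine ⟨T ∪ U.biUnion Q, union_subset hT (biUnion_subset.2 fun s _ => hQE s), ?_, ?_⟩
  · intro s hsX
    by_cases hr : Reach T G.r s
    · exact hr.mono subset_union_left
    · exact (hQ s hsX).1.mono ((subset_biUnion_of_mem Q (mem_filter.2 ⟨hsX, hr⟩)).trans
        subset_union_right)
  · have a1 : ∑ e ∈ T ∪ U.biUnion Q, c e ≤ ∑ e ∈ T, c e + ∑ e ∈ U.biUnion Q, c e := by
      rw [← sum_union_inter]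
      have : 0 ≤ ∑ e ∈ T ∩ U.biUnion Q, c e :=
        sum_nonneg fun e he => hc e (hT (mem_inter.1 he).1)
      linarith
    have a2 : ∀ U' ⊆ G.X, ∑ e ∈ U'.biUnion Q, c e ≤ ∑ s ∈ U', LP := by
      intro U'
      induction U' using Finset.induction_on with
      | empty => simp
      | insert a J ha ih =>
        intro hJ
        rw [biUnion_insert, sum_insert ha]
        have b1 := ih ((subset_insert _ _).trans hJ)
        have b2 := (hQ a (hJ (mem_insert_self _ _))).2
        have b3 : 0 ≤ ∑ e ∈ Q a ∩ J.biUnion Q, c e :=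
          sum_nonneg fun e he => hc e (hQE a (mem_inter.1 he).1)
        have b4 := sum_union_inter (s₁ := Q a) (s₂ := J.biUnion Q) (f := c)
        linarith
    have a3 : ∑ s ∈ U, LP = ∑ s ∈ G.X, LP * nrch T G.r s := by
      rw [sum_filter]
      refine sum_congr rfl fun s _ => ?_
      by_cases hr : Reach T G.r s <;> simp [nrch, hr]
    have a4 := a2 U (filter_subset _ _)
    have a5 : (N : ℝ) * LP ≤ 2 * (G.levels : ℝ) * Real.logb 2 (G.X.card : ℝ) * LP :=
      mul_le_mul_of_nonneg_right hN1 hLP0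
    have a6 := mul_le_mul_of_nonneg_right hN2 hLP0
    have a7 : (G.X.card : ℝ) * (LP * (1 - 1 / (G.levels + 1 : ℝ)) ^ N)
      = (G.X.card : ℝ) * (1 - 1 / (G.levels + 1 : ℝ)) ^ N * LP := by ring
    rw [a7] at hcost
    linarith

end core

/-! ### Extracting the linear facts from the Lasserre solution -/

/-- Capacity variable. -/
def yv (G : DSTInstance V) (e : {e : V × V // e ∈ G.E}) : DSTVar G := Sum.inl e

/-- Flow variable. -/
def fv (G : DSTInstance V) (p : {p : V × (V × V) // p.1 ∈ G.X ∧ p.2 ∈ G.E}) : DSTVar G :=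
  Sum.inr p

lemma dst_sum (G : DSTInstance V) (φ : DSTVar G → ℝ) :
    ∑ i, φ i = ∑ e : {e : V × V // e ∈ G.E}, φ (yv G e)
      + ∑ p : {p : V × (V × V) // p.1 ∈ G.X ∧ p.2 ∈ G.E}, φ (fv G p) :=
  Fintype.sum_sum_type φ

lemma edgeVars_eq (G : DSTInstance V) (P : Finset (V × V)) :
    edgeVars G P = ((Finset.univ : Finset {e : V × V // e ∈ G.E}).filter
      (fun e => e.1 ∈ P)).image (yv G) := rfl

/-- Flow variables of terminal `s` on the edges of `P`. -/
def flowVars (G : DSTInstance V) (s : V) (P : Finset (V × V)) : Finset (DSTVar G) :=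
  ((Finset.univ : Finset {p : V × (V × V) // p.1 ∈ G.X ∧ p.2 ∈ G.E}).filter
    (fun p => p.1.1 = s ∧ p.1.2 ∈ P)).image (fv G)

lemma edgeVars_insert (G : DSTInstance V) (e : {e : V × V // e ∈ G.E}) (P : Finset (V × V)) :
    edgeVars G (insert e.1 P) = insert (yv G e) (edgeVars G P) := by
  rw [edgeVars_eq, edgeVars_eq]
  rw [← image_insert]
  congr 1
  ext x
  simp only [mem_filter, mem_univ, true_and, mem_insert]
  rw [Subtype.ext_iff]

lemma flowVars_insert (G : DSTInstance V)
    (p : {p : V × (V × V) // p.1 ∈ G.X ∧ p.2 ∈ G.E}) (P : Finset (V × V)) :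
    flowVars G p.1.1 (insert p.1.2 P) = insert (fv G p) (flowVars G p.1.1 P) := by
  unfold flowVars
  rw [← image_insert]
  congr 1
  ext x
  simp only [mem_filter, mem_univ, true_and, mem_insert, Subtype.ext_iff, Prod.ext_iff]
  tauto

lemma card_edgeVars_le (G : DSTInstance V) (P : Finset (V × V)) :
    (edgeVars G P).card ≤ P.card := by
  rw [edgeVars_eq]
  refine card_image_le.trans (card_le_card_of_injOn (fun e => e.1) ?_ ?_)
  · intro e he; exact (mem_filter.1 he).2
  · intro a _ b _ h; exact Subtype.ext h

lemma card_flowVars_le (G : DSTInstance V) (s : V) (P : Finset (V × V)) :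
    (flowVars G s P).card ≤ P.card := by
  refine card_image_le.trans (card_le_card_of_injOn (fun p => p.1.2) ?_ ?_)
  · intro e he; exact (mem_filter.1 he).2.2
  · intro a ha b hb h
    have h1 := (mem_filter.1 ha).2.1
    have h2 := (mem_filter.1 hb).2.1
    exact Subtype.ext (Prod.ext (h1.trans h2.symm) h)

section las

variable {G : DSTInstance V} {L : ℕ} {Y : Finset (DSTVar G) → ℝ}

lemma las_nonneg (hY : IsLasserre (dstA G) (dstb G) L Y)
    (I : Finset (DSTVar G)) (hI : I.card ≤ L + 1) : 0 ≤ Y I := by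
  have := hY.2.1.diag_nonneg (i := ⟨I, hI⟩)
  simpa [momentMatrix] using this

lemma las_shift (hY : IsLasserre (dstA G) (dstb G) L Y)
    (k : DSTCon G) (I : Finset (DSTVar G)) (hI : I.card ≤ L) :
    0 ≤ (∑ i, dstA G k i * Y (insert i I)) - dstb G k * Y I := by
  have := (hY.2.2 k).diag_nonneg (i := ⟨I, hI⟩)
  simpa only [momentMatrix, shiftVec, union_self] using this

lemma las_in (hY : IsLasserre (dstA G) (dstb G) L Y)
    (P : Finset (V × V)) (v : V) (hP : P.card ≤ L) :
    ∑ e ∈ G.E.filter (fun e => e.2 = v), Y (edgeVars G (insert e P)) ≤ Y (edgeVars G P) := by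
  have h := las_shift hY (Sum.inr (Sum.inr (Sum.inl v))) (edgeVars G P)
    ((card_edgeVars_le G P).trans hP)
  rw [dst_sum] at h
  have y1 : ∀ e, dstA G (Sum.inr (Sum.inr (Sum.inl v))) (yv G e)
    = if e.1.2 = v then (-1 : ℝ) else 0 := fun _ => rfl
  have y2 : ∀ p, dstA G (Sum.inr (Sum.inr (Sum.inl v))) (fv G p) = 0 := fun _ => rfl
  have y3 : dstb G (Sum.inr (Sum.inr (Sum.inl v))) = -1 := rfl
  simp only [y1, y2, y3, zero_mul, sum_const_zero, add_zero] at h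
  have e1 : ∑ e : {e : V × V // e ∈ G.E},
      (if e.1.2 = v then (-1 : ℝ) else 0) * Y (insert (yv G e) (edgeVars G P))
      = ∑ e ∈ G.E, (if e.2 = v then (-1 : ℝ) else 0) * Y (edgeVars G (insert e P)) := by
    rw [← Finset.sum_coe_sort G.E]
    exact sum_congr rfl fun e _ => by rw [edgeVars_insert]
  rw [e1] at h
  have e2 : ∑ e ∈ G.E, (if e.2 = v then (-1 : ℝ) else 0) * Y (edgeVars G (insert e P))
      = - ∑ e ∈ G.E.filter (fun e => e.2 = v), Y (edgeVars G (insert e P)) := by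
    rw [sum_filter, ← sum_neg_distrib]
    exact sum_congr rfl fun e _ => by split_ifs <;> simp
  rw [e2] at h
  linarith

lemma las_cap (hY : IsLasserre (dstA G) (dstb G) L Y)
    (p : {p : V × (V × V) // p.1 ∈ G.X ∧ p.2 ∈ G.E}) (I : Finset (DSTVar G))
    (hI : I.card ≤ L) :
    Y (insert (fv G p) I)
      ≤ Y (insert (yv G ⟨p.1.2, p.2.2⟩) I) := by
  have h := las_shift hY (Sum.inr (Sum.inl p)) I hI
  rw [dst_sum] at h
  have y1 : ∀ e, dstA G (Sum.inr (Sum.inl p)) (yv G e)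
    = if e.1 = p.1.2 then (1 : ℝ) else 0 := fun _ => rfl
  have y2 : ∀ q, dstA G (Sum.inr (Sum.inl p)) (fv G q)
    = if q.1 = p.1 then (-1 : ℝ) else 0 := fun _ => rfl
  have y3 : dstb G (Sum.inr (Sum.inl p)) = 0 := rfl
  simp only [y1, y2, y3, zero_mul, sub_zero] at h
  rw [sum_eq_single (⟨p.1.2, p.2.2⟩ : {e : V × V // e ∈ G.E}), sum_eq_single p] at h
  · simp at h; linarith
  · intro q _ hq
    rw [if_neg (fun hh => hq (Subtype.ext hh)), zero_mul]
  · simp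
  · intro q _ hq
    rw [if_neg (fun hh => hq (Subtype.ext hh)), zero_mul]
  · simp

lemma las_flow (hY : IsLasserre (dstA G) (dstb G) L Y)
    (s : V) (hs : s ∈ G.X) (u : V) (P : Finset (V × V)) (hP : P.card ≤ L) :
    ∑ e ∈ G.E.filter (fun e => e.2 = u), Y (flowVars G s (insert e P))
      + (if u = G.r then 1 else if u = s then -1 else 0) * Y (flowVars G s P)
    ≤ ∑ e ∈ G.E.filter (fun e => e.1 = u), Y (flowVars G s (insert e P)) := by
  have h := las_shift hY (Sum.inl ((⟨s, hs⟩, u), true)) (flowVars G s P)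
    ((card_flowVars_le G s P).trans hP)
  rw [dst_sum] at h
  have y1 : ∀ e, dstA G (Sum.inl ((⟨s, hs⟩, u), true)) (yv G e) = 1 * 0 := fun _ => rfl
  have y2 : ∀ p, dstA G (Sum.inl ((⟨s, hs⟩, u), true)) (fv G p) = 1 * (if p.1.1 = s then
      (if p.1.2.1 = u then (1 : ℝ) else 0) - (if p.1.2.2 = u then (1 : ℝ) else 0) else 0) :=
    fun _ => rfl
  have y3 : dstb G (Sum.inl ((⟨s, hs⟩, u), true))
    = 1 * (if u = G.r then 1 else if u = s then -1 else 0) := rfl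
  simp only [y1, y2, y3, zero_mul, mul_zero, sum_const_zero, zero_add, one_mul] at h
  let ψ : V × (V × V) → ℝ := fun p => (if p.1 = s then
    (if p.2.1 = u then (1 : ℝ) else 0) - (if p.2.2 = u then (1 : ℝ) else 0) else 0)
      * Y (flowVars G s (insert p.2 P))
  have e1 : ∑ p : {p : V × (V × V) // p.1 ∈ G.X ∧ p.2 ∈ G.E}, (if p.1.1 = s then
      (if p.1.2.1 = u then (1 : ℝ) else 0) - (if p.1.2.2 = u then (1 : ℝ) else 0) else 0)
      * Y (insert (fv G p) (flowVars G s P)) = ∑ p ∈ G.X ×ˢ G.E, ψ p := by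
    rw [Finset.sum_subtype (G.X ×ˢ G.E) (p := fun p => p.1 ∈ G.X ∧ p.2 ∈ G.E)
      (fun x => mem_product) ψ]
    refine sum_congr rfl fun p _ => ?_
    by_cases hp : p.1.1 = s
    · subst hp
      simp only [ψ]
      rw [flowVars_insert]
    · simp [ψ, hp]
  have e2 : ∑ p ∈ G.X ×ˢ G.E, ψ p
      = ∑ e ∈ G.E.filter (fun e => e.1 = u), Y (flowVars G s (insert e P))
        - ∑ e ∈ G.E.filter (fun e => e.2 = u), Y (flowVars G s (insert e P)) := by
    rw [sum_product, sum_eq_single_of_mem s hs, sum_filter, sum_filter, ← sum_sub_distrib]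
    · refine sum_congr rfl fun e _ => ?_
      simp only [ψ, if_true, sub_mul, ite_mul, one_mul, zero_mul]
    · intro b _ hb
      exact sum_eq_zero fun e _ => by simp [ψ, hb]
  rw [e1, e2] at h
  linarith

lemma las_flow_le (hY : IsLasserre (dstA G) (dstb G) L Y)
    (s : V) (hs : s ∈ G.X) (A : Finset (V × V)) (hA : A ⊆ G.E)
    (B : Finset (V × V)) (hc : A.card + B.card ≤ L + 1) :
    Y (flowVars G s A ∪ edgeVars G B) ≤ Y (edgeVars G (A ∪ B)) := by
  induction A using Finset.induction_on generalizing B with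
  | empty => simp [flowVars]
  | insert e A he ih =>
    have heE := hA (mem_insert_self _ _)
    rw [card_insert_of_notMem he] at hc
    have h1 := flowVars_insert G ⟨(s, e), hs, heE⟩ A
    have h2 := edgeVars_insert G ⟨e, heE⟩ B
    simp only at h1 h2
    have hI : (flowVars G s A ∪ edgeVars G B).card ≤ L := by
      have a := card_union_le (flowVars G s A) (edgeVars G B)
      have b := card_flowVars_le G s A
      have c := card_edgeVars_le G B
      omega
    have h3 := las_cap hY ⟨(s, e), hs, heE⟩ _ hI
    have h4 := ih ((subset_insert _ _).trans hA) (insert e B)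
      (by have := card_insert_le e B; omega)
    rw [h1, insert_union, insert_union]
    refine h3.trans ?_
    rw [← union_insert, ← h2, ← union_insert]
    exact h4

lemma las_out (hY : IsLasserre (dstA G) (dstb G) L Y)
    (s : V) (hs : s ∈ G.X) (u : V)
    (P : Finset (V × V)) (hP : P.card ≤ L)
    (hu : u = G.r ∨ ∃ e ∈ P, e ∈ G.E ∧ e.2 = u) (hus : u ≠ s) : Y (flowVars G s P)
      ≤ ∑ e ∈ G.E.filter (fun e => e.1 = u), Y (flowVars G s (insert e P)) := by
  have hin0 : ∀ e, 0 ≤ Y (flowVars G s (insert e P)) := fun e =>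
    las_nonneg hY _ ((card_flowVars_le G s _).trans (by have := card_insert_le e P; omega))
  have hf := las_flow hY s hs u P hP
  by_cases hur : u = G.r
  · rw [if_pos hur, one_mul] at hf
    have : 0 ≤ ∑ e ∈ G.E.filter (fun e => e.2 = u), Y (flowVars G s (insert e P)) :=
      sum_nonneg fun e _ => hin0 e
    linarith
  · rw [if_neg hur, if_neg hus, zero_mul, add_zero] at hf
    obtain ⟨e, heP, heE, heu⟩ := hu.resolve_left hur
    have := single_le_sum (f := fun e => Y (flowVars G s (insert e P)))
      (fun e' _ => hin0 e') (mem_filter.2 ⟨heE, heu⟩ : e ∈ G.E.filter (fun e => e.2 = u))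
    simp only [insert_eq_of_mem heP] at this
    linarith

lemma las_path (hY : IsLasserre (dstA G) (dstb G) L Y)
    (s : V) (hs : s ∈ G.X) (n : ℕ) (u : V)
    (P : Finset (V × V)) (hn : G.level u + n = G.levels) (hP : P.card + n ≤ L)
    (hu : u = G.r ∨ ∃ e ∈ P, e ∈ G.E ∧ e.2 = u) :
    Y (flowVars G s P) ≤ W G n u s (fun R => Y (flowVars G s R)) P := by
  have hls : G.level s = G.levels := (G.level_terminal s).2 hs
  induction n generalizing u P with
  | zero =>
    simp only [W]
    split_ifs with hus
    · exact le_rfl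
    · refine (las_out hY s hs u P (by omega) hu hus).trans (le_of_eq ?_)
      rw [filter_eq_empty_iff.2, sum_empty]
      intro e he heu
      have h1 := G.edge_level e he
      have h2 := G.level_le e.2
      rw [heu] at h1; omega
  | succ n ih =>
    have hus : u ≠ s := by rintro rfl; omega
    refine (las_out hY s hs u P (by omega) hu hus).trans ?_
    simp only [W]
    refine sum_le_sum fun e he => ?_
    obtain ⟨heE, heu⟩ := mem_filter.1 he
    have h1 := G.edge_level e heE
    have h2 := card_insert_le e P
    rw [heu] at h1
    exact ih e.2 (insert e P) (by omega) (by omega) (Or.inr ⟨e, mem_insert_self _ _, heE, rfl⟩)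

end las

/-- Integrality gap bound (existence form): for an `ℓ`-level Directed Steiner Tree instance
with `|X| ≥ 2`, nonnegative edge costs `c`, and a level-`2ℓ` Lasserre solution `Y`, there is
a feasible integral solution `T ⊆ E` (containing an `r`–`s` path for each terminal `s`) of
cost at most `(2ℓ·log₂|X| + 1) · Σ_{e ∈ E} c_e · y_{{e}}`. -/
theorem dst_lasserre_integrality_gap (G : DSTInstance V)
    (c : V × V → ℝ) (hc : ∀ e ∈ G.E, 0 ≤ c e) (hX : 2 ≤ G.X.card)
    (Y : Finset (DSTVar G) → ℝ)
    (hY : IsLasserre (dstA G) (dstb G) (2 * G.levels) Y) :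
    ∃ T : Finset (V × V), T ⊆ G.E ∧
      (∀ s ∈ G.X, ∃ P : Finset (V × V), IsRPath G P s ∧ P ⊆ T) ∧
      ∑ e ∈ T, c e ≤
        (2 * (G.levels : ℝ) * Real.logb 2 (G.X.card : ℝ) + 1) *
          ∑ e ∈ G.E, c e * Y (edgeVars G {e}) := by
  have hr : G.level G.r = 0 := (G.level_root G.r).2 rfl
  have hl : 1 ≤ G.levels := by
    by_contra h
    have h0 : G.levels = 0 := by omega
    have : G.X.card ≤ 1 := by
      refine card_le_one.2 fun a ha b hb => ?_
      have h1 := (G.level_root a).1 (((G.level_terminal a).2 ha).trans h0)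
      have h2 := (G.level_root b).1 (((G.level_terminal b).2 hb).trans h0)
      rw [h1, h2]
    omega
  obtain ⟨T, hT, hreach, hcost⟩ := core G c (fun P => Y (edgeVars G P)) hc hX hl (2 * G.levels)
    (by omega) (fun P v hP => las_in hY P v hP)
    (fun P hP => las_nonneg hY _ ((card_edgeVars_le G P).trans hP))
    (by
      have : edgeVars G ∅ = ∅ := by simp [edgeVars_eq]
      simp only [this]; exact hY.1)
    (by
      intro s hs
      have h1 := las_path hY s hs G.levels G.r ∅ (by omega) (by simp; omega) (Or.inl rfl)
      have h0 : flowVars G s ∅ = ∅ := by simp [flowVars]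
      rw [h0, hY.1] at h1
      refine h1.trans (W_mono _ _ _ _ _ _ _ fun R _ hR hcard _ => ?_)
      have := las_flow_le hY s hs R (by simpa using hR) ∅ (by simp at hcard ⊢; omega)
      simpa [edgeVars_eq] using this)
  exact ⟨T, hT, fun s hs => (hreach s hs).isRPath G hT, hcost⟩
end
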